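/- arXiv:math/0211324 — 3 statements merged into one kernel-verified Lean document; each statement's English description precedes it below -/
import Mathlib

section
/- Let f : ℂ^k → ℂ^k be continuous, d > 1, 0 < c′ ≤ 1 ≤ c, and R ≥ 1 with c′·R^d ≥ R. Let S ⊆ {z ∈ ℂ^k : |z| ≥ R} satisfy f(S) ⊆ S and c′·|z|^d ≤ |f(z)| ≤ c·|z|^d for all z ∈ S. Set G_n(z) := d^{−n}·log|f^n(z)|. Then |f^n(z)| ≥ R for all n and z ∈ S, |G_n(z) − G_{n−1}(z)| ≤ max(log c, −log c′)·d^{−n} for all n ≥ 1 and z ∈ S, the sequence (G_n) converges uniformly on S to a continuous function G, and G satisfies G(f(z)) = d·G(z) and |G(z) − log|z|| ≤ max(log c, −log c′)/(d − 1) for all z ∈ S. -/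
open Filter Topology Set

/-- A sequence of functions with summable increments converges uniformly, to a limit within the
total increment of the initial function. -/
theorem exists_tendstoUniformlyOn_of_abs_sub_le {α : Type*} {S : Set α} {F : ℕ → α → ℝ}
    {u : ℕ → ℝ} (hu : Summable u) (h : ∀ n, ∀ x ∈ S, |F (n + 1) x - F n x| ≤ u n) :
    ∃ g : α → ℝ, TendstoUniformlyOn F g atTop S ∧ ∀ x ∈ S, |g x - F 0 x| ≤ ∑' n, u n := by
  have ht := tendstoUniformlyOn_tsum_nat (f := fun n x => F (n + 1) x - F n x) hu h
  refine ⟨fun x => F 0 x + ∑' n, (F (n + 1) x - F n x), ?_, fun x hx => ?_⟩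
  · rw [Metric.tendstoUniformlyOn_iff] at ht ⊢
    intro ε hε
    filter_upwards [ht ε hε] with N hN x hx
    have := hN x hx
    rw [Finset.sum_range_sub (fun n => F n x), Real.dist_eq] at this
    rw [Real.dist_eq]
    convert this using 2
    ring
  · rw [add_sub_cancel_left]
    exact tsum_of_norm_bounded (f := fun n => F (n + 1) x - F n x) hu.hasSum fun n => h n x hx

/-- Two-sided power bounds become an additive estimate after taking logarithms. -/
theorem abs_log_sub_mul_log_le {a b c c' d : ℝ} (ha : 0 < a) (hc' : 0 < c') (hc : 0 < c)
    (hlow : c' * a ^ d ≤ b) (hup : b ≤ c * a ^ d) :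
    |Real.log b - d * Real.log a| ≤ max (Real.log c) (-Real.log c') := by
  have hp : 0 < a ^ d := Real.rpow_pos_of_pos ha d
  have hb : 0 < b := (mul_pos hc' hp).trans_le hlow
  have h1 := Real.log_le_log (mul_pos hc' hp) hlow
  have h2 := Real.log_le_log hb hup
  rw [Real.log_mul hc'.ne' hp.ne', Real.log_rpow ha] at h1
  rw [Real.log_mul hc.ne' hp.ne', Real.log_rpow ha] at h2
  rw [abs_le]
  constructor
  · linarith [le_max_right (Real.log c) (-Real.log c')]
  · linarith [le_max_left (Real.log c) (-Real.log c')]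

/-- The geometric series `∑ M / d ^ (n + 1)` has sum `M / (d - 1)`. -/
theorem hasSum_div_pow_succ {d : ℝ} (hd : 1 < d) (M : ℝ) :
    HasSum (fun n : ℕ => M / d ^ (n + 1)) (M / (d - 1)) := by
  have hd0 : 0 < d := one_pos.trans hd
  have hd1 : d - 1 ≠ 0 := (sub_pos.2 hd).ne'
  have h := (hasSum_geometric_of_lt_one (inv_nonneg.2 hd0.le) (inv_lt_one_of_one_lt₀ hd)).mul_left
    (M / d)
  have hsum : M / d * (1 - d⁻¹)⁻¹ = M / (d - 1) := by
    rw [div_mul_eq_mul_div, ← div_eq_mul_inv, div_div, sub_mul, one_mul, inv_mul_cancel₀ hd0.ne']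
  rw [hsum] at h
  refine h.congr_fun ?_
  intro n
  rw [inv_pow, pow_succ]
  field_simp

/-- Uniform Cauchy estimate giving continuity of the partial Green
functions on the basins: if `f` is continuous, maps `S ⊆ {‖z‖ ≥ R}` into itself with
`c'‖z‖^d ≤ ‖f z‖ ≤ c‖z‖^d` on `S` (`d > 1`, `0 < c' ≤ 1 ≤ c`, `R ≥ 1`, `c' R^d ≥ R`),
then with `G_n(z) := d^{-n} log‖f^n(z)‖`: the orbit stays in `{‖·‖ ≥ R}`,
`|G_n − G_{n−1}| ≤ max(log c, −log c')/d^n`, the `G_n` converge uniformly on `S` to a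
continuous `G` with `G(f z) = d·G(z)` and `|G(z) − log‖z‖| ≤ max(log c, −log c')/(d−1)`. -/
theorem stmt1 (k : ℕ)
    (f : EuclideanSpace ℂ (Fin k) → EuclideanSpace ℂ (Fin k))
    (hcont : Continuous f)
    (d c c' R : ℝ) (hd : 1 < d) (hc' : 0 < c') (hc'le : c' ≤ 1) (hc : 1 ≤ c)
    (hR : 1 ≤ R) (hRfix : R ≤ c' * R ^ d)
    (S : Set (EuclideanSpace ℂ (Fin k)))
    (hSR : ∀ z ∈ S, R ≤ ‖z‖)
    (hmaps : MapsTo f S S)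
    (hlow : ∀ z ∈ S, c' * ‖z‖ ^ d ≤ ‖f z‖)
    (hup : ∀ z ∈ S, ‖f z‖ ≤ c * ‖z‖ ^ d)
    (G : ℕ → EuclideanSpace ℂ (Fin k) → ℝ)
    (hG : ∀ n z, G n z = (d ^ n)⁻¹ * Real.log ‖f^[n] z‖) :
    (∀ n : ℕ, ∀ z ∈ S, R ≤ ‖f^[n] z‖) ∧
    (∀ n : ℕ, 1 ≤ n → ∀ z ∈ S,
      |G n z - G (n - 1) z| ≤ max (Real.log c) (-Real.log c') / d ^ n) ∧
    ∃ Glim : EuclideanSpace ℂ (Fin k) → ℝ,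
      ContinuousOn Glim S ∧
      TendstoUniformlyOn (fun n z => G n z) Glim atTop S ∧
      ∀ z ∈ S, Glim (f z) = d * Glim z ∧
        |Glim z - Real.log ‖z‖| ≤ max (Real.log c) (-Real.log c') / (d - 1) := by
  have hd0 : 0 < d := one_pos.trans hd
  have horb : ∀ n : ℕ, ∀ z ∈ S, f^[n] z ∈ S := fun n z hz => hmaps.iterate n hz
  have hnorm : ∀ n : ℕ, ∀ z ∈ S, R ≤ ‖f^[n] z‖ := fun n z hz => hSR _ (horb n z hz)
  have hpos : ∀ n : ℕ, ∀ z ∈ S, 0 < ‖f^[n] z‖ := fun n z hz =>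
    one_pos.trans_le (hR.trans (hnorm n z hz))
  have hstep : ∀ n : ℕ, ∀ z ∈ S,
      |G (n + 1) z - G n z| ≤ max (Real.log c) (-Real.log c') / d ^ (n + 1) := by
    intro n z hz
    have h := abs_log_sub_mul_log_le (hpos n z hz) hc' (one_pos.trans_le hc)
      (hlow _ (horb n z hz)) (hup _ (horb n z hz))
    have heq : G (n + 1) z - G n z =
        (Real.log ‖f (f^[n] z)‖ - d * Real.log ‖f^[n] z‖) / d ^ (n + 1) := by
      rw [hG, hG, Function.iterate_succ_apply', pow_succ]
      field_simp
    rw [heq, abs_div, abs_of_pos (pow_pos hd0 (n + 1))]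
    gcongr
  have hsum := hasSum_div_pow_succ hd (max (Real.log c) (-Real.log c'))
  obtain ⟨g, hg, hg0⟩ := exists_tendstoUniformlyOn_of_abs_sub_le hsum.summable hstep
  have hGcont : ∀ n, ContinuousOn (G n) S := by
    intro n
    rw [funext (hG n)]
    exact continuousOn_const.mul
      ((hcont.iterate n).norm.continuousOn.log fun z hz => (hpos n z hz).ne')
  refine ⟨hnorm, ?_, g, hg.continuousOn (Eventually.of_forall hGcont).frequently, hg, ?_⟩
  · intro n hn z hz
    obtain ⟨m, rfl⟩ := Nat.exists_eq_add_of_le' hn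
    exact hstep m z hz
  · intro z hz
    constructor
    · have hfun : ∀ n, G n (f z) = d * G (n + 1) z := by
        intro n
        rw [hG, hG, Function.iterate_succ_apply, pow_succ]
        field_simp
      refine tendsto_nhds_unique (hg.tendsto_at (hmaps hz)) ?_
      simp only [hfun]
      exact ((tendsto_add_atTop_iff_nat 1).2 (hg.tendsto_at hz)).const_mul d
    · have h := hg0 z hz
      rw [hsum.tsum_eq] at h
      simpa [hG] using h
end

section
/- Assume that {z ∈ ℂ^k : P^+_{(1)}(z) = ⋯ = P^+_{(m)}(z) = 0} = {0}; this holds in particular whenever f is regular. Then there exist c > 0 and R > 0 such that |f(z)| ≥ c·|z|^{d_m} for every z ∈ ℂ^k with |z| ≥ R; in particular f is a proper map. Consequently, the Łojasiewicz exponent of f (the supremum of the λ > 0 for which |f(z)| ≥ c·|z|^λ holds for some c > 0 and all |z| large) is at least d_m. -/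
open MvPolynomial Filter Topology Metric Set

noncomputable section

def logPlus (x : ℝ) : ℝ := max (Real.log x) 0

/-- The top-degree homogeneous part of the `j`-th coordinate polynomial of `P`. -/
def pPlus (k : ℕ) (P : Fin k → MvPolynomial (Fin k) ℂ) (j : Fin k) :
    MvPolynomial (Fin k) ℂ :=
  homogeneousComponent (P j).totalDegree (P j)

/-- `Σ_i`: unit-sphere slice of the affine cone over the attracting set `X_i` at
infinity: `‖w‖ = 1`, `P⁺_{(1)}(w) = ⋯ = P⁺_{(i−1)}(w) = 0` and `w_{(>i)} = 0`. -/
def sigmaSet (k : ℕ) (P : Fin k → MvPolynomial (Fin k) ℂ) (l : ℕ → ℕ) (i : ℕ) :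
    Set (EuclideanSpace ℂ (Fin k)) :=
  {w | ‖w‖ = 1 ∧ (∀ j : Fin k, (j : ℕ) < l (i - 1) → eval (fun t => w t) (pPlus k P j) = 0) ∧
    ∀ j : Fin k, l i ≤ (j : ℕ) → w j = 0}

/-- `U_i`: basin of the attracting set `X_i` at infinity. -/
def basin (k : ℕ) (f : EuclideanSpace ℂ (Fin k) → EuclideanSpace ℂ (Fin k))
    (P : Fin k → MvPolynomial (Fin k) ℂ) (l : ℕ → ℕ) (i : ℕ) :
    Set (EuclideanSpace ℂ (Fin k)) :=
  {z | Tendsto (fun n => ‖f^[n] z‖) atTop atTop ∧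
    Tendsto (fun n => infDist (‖f^[n] z‖⁻¹ • f^[n] z) (sigmaSet k P l i)) atTop (𝓝 0)}

/-- `K_i = K_{i−1} \ U_i` (with `K_0 = ℂ^k`), unfolded as the complement of
`U_1 ∪ ⋯ ∪ U_i`. -/
def kSet (k : ℕ) (f : EuclideanSpace ℂ (Fin k) → EuclideanSpace ℂ (Fin k))
    (P : Fin k → MvPolynomial (Fin k) ℂ) (l : ℕ → ℕ) (i : ℕ) :
    Set (EuclideanSpace ℂ (Fin k)) :=
  {z | ∀ j : ℕ, 1 ≤ j → j ≤ i → z ∉ basin k f P l j}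

/-- Euclidean norm of the sub-vector of the coordinates `a ≤ j < b`. -/
def blockNorm (k : ℕ) (z : EuclideanSpace ℂ (Fin k)) (a b : ℕ) : ℝ :=
  Real.sqrt (∑ j : Fin k, if a ≤ (j : ℕ) ∧ (j : ℕ) < b then ‖z j‖ ^ 2 else 0)

end

namespace MvPolynomial

theorem exists_norm_eval_le {k n : ℕ} (q : MvPolynomial (Fin k) ℂ)
    (hq : ∀ s ∈ q.support, s.degree ≤ n) :
    ∃ C : ℝ, 0 ≤ C ∧ ∀ z : EuclideanSpace ℂ (Fin k), 1 ≤ ‖z‖ →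
      ‖eval (fun t => z t) q‖ ≤ C * ‖z‖ ^ n := by
  refine ⟨∑ s ∈ q.support, ‖q.coeff s‖, Finset.sum_nonneg fun _ _ => norm_nonneg _, ?_⟩
  intro z hz
  rw [eval_eq', Finset.sum_mul]
  refine (norm_sum_le _ _).trans (Finset.sum_le_sum fun s hs => ?_)
  rw [norm_mul]
  gcongr
  calc ‖∏ i, z i ^ s i‖ = ∏ i, ‖z i‖ ^ s i := by simp [norm_prod, norm_pow]
    _ ≤ ∏ i, ‖z‖ ^ s i := by
        gcongr with i
        exact PiLp.norm_apply_le z i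
    _ = ‖z‖ ^ s.degree := by rw [Finset.prod_pow_eq_pow_sum, Finsupp.degree_eq_sum]
    _ ≤ ‖z‖ ^ n := pow_le_pow_right₀ hz (hq s hs)

theorem IsHomogeneous.eval_smul {σ R : Type*} [Fintype σ] [CommSemiring R] {n : ℕ}
    {φ : MvPolynomial σ R} (hφ : φ.IsHomogeneous n) (a : R) (z : σ → R) :
    eval (a • z) φ = a ^ n * eval z φ := by
  rw [eval_eq', eval_eq', Finset.mul_sum]
  refine Finset.sum_congr rfl fun s hs => ?_
  have hdeg : ∑ i, s i = n := by
    rw [← Finsupp.degree_eq_sum, Finsupp.degree_eq_weight_one]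
    exact hφ (mem_support_iff.mp hs)
  simp only [Pi.smul_apply, smul_eq_mul, mul_pow, Finset.prod_mul_distrib,
    Finset.prod_pow_eq_pow_sum, hdeg]
  ring

theorem degree_le_of_mem_support_sub_homogeneousComponent {σ R : Type*} [CommRing R]
    {p : MvPolynomial σ R} {s : σ →₀ ℕ}
    (hs : s ∈ (p - homogeneousComponent p.totalDegree p).support) :
    s.degree ≤ p.totalDegree - 1 := by
  rw [mem_support_iff, coeff_sub, coeff_homogeneousComponent] at hs
  have hne : s.degree ≠ p.totalDegree := by
    intro h
    simp [h] at hs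
  rw [if_neg hne, sub_zero] at hs
  have hle : s.degree ≤ p.totalDegree := le_totalDegree (mem_support_iff.mpr hs)
  omega

theorem continuous_eval_euclideanSpace {k : ℕ} (q : MvPolynomial (Fin k) ℂ) :
    Continuous fun z : EuclideanSpace ℂ (Fin k) => eval (fun t => z t) q := by
  have h := MvPolynomial.continuous_eval q
  fun_prop

theorem exists_le_norm_eval_on_sphere {k : ℕ} (Q : Fin k → MvPolynomial (Fin k) ℂ)
    (hQ : ∀ z : Fin k → ℂ, (∀ j, eval z (Q j) = 0) → z = 0) :
    ∃ δ : ℝ, 0 < δ ∧ ∀ z : EuclideanSpace ℂ (Fin k), ‖z‖ = 1 →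
      ∃ j, δ ≤ ‖eval (fun t => z t) (Q j)‖ := by
  have hcont : Continuous fun z : EuclideanSpace ℂ (Fin k) =>
      ‖fun j => eval (fun t => z t) (Q j)‖ :=
    (continuous_pi fun j => continuous_eval_euclideanSpace (Q j)).norm
  obtain ⟨δ, hδ, hle⟩ := (isCompact_sphere (0 : EuclideanSpace ℂ (Fin k)) 1).exists_forall_le'
    hcont.continuousOn (a := 0) (by
      intro z hz
      refine norm_pos_iff.mpr fun h0 => ?_
      have hz0 := hQ (fun t => z t) (congrFun h0)
      have : z = 0 := by
        ext t
        exact congrFun hz0 t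
      simp [this] at hz)
  refine ⟨δ, hδ, fun z hz => ?_⟩
  by_contra! h
  exact absurd (hle z (by simpa using hz)) (not_le.mpr ((pi_norm_lt_iff hδ).mpr h))

theorem exists_le_norm_eval_of_top {k e : ℕ} (P : Fin k → MvPolynomial (Fin k) ℂ) (he : 1 ≤ e)
    (hP : ∀ j, e ≤ (P j).totalDegree)
    (hreg : ∀ z : Fin k → ℂ,
      (∀ j, eval z (homogeneousComponent (P j).totalDegree (P j)) = 0) → z = 0) :
    ∃ c R : ℝ, 0 < c ∧ 1 ≤ R ∧ ∀ z : EuclideanSpace ℂ (Fin k), R ≤ ‖z‖ →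
      ∃ j, c * ‖z‖ ^ e ≤ ‖eval (fun t => z t) (P j)‖ := by
  obtain ⟨δ, hδ, hsph⟩ := exists_le_norm_eval_on_sphere _ hreg
  choose C hC0 hC using fun j => exists_norm_eval_le
    (P j - homogeneousComponent (P j).totalDegree (P j))
    (fun _ => degree_le_of_mem_support_sub_homogeneousComponent)
  refine ⟨δ / 2, 1 + 2 * (∑ j, C j) / δ, by positivity, ?_, ?_⟩
  · have : 0 ≤ 2 * (∑ j, C j) / δ := by
      have := Finset.sum_nonneg fun j (_ : j ∈ Finset.univ) => hC0 j
      positivity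
    linarith
  intro z hz
  have hsum : 0 ≤ ∑ j, C j := Finset.sum_nonneg fun j _ => hC0 j
  have hquot : 0 ≤ 2 * (∑ j, C j) / δ := by positivity
  have hz1 : 1 ≤ ‖z‖ := by linarith
  have hz0 : ‖z‖ ≠ 0 := by positivity
  obtain ⟨j, hj⟩ := hsph ((‖z‖⁻¹ : ℂ) • z) (by
    simp [norm_smul, hz0])
  refine ⟨j, ?_⟩
  obtain ⟨n, hn⟩ : ∃ n, (P j).totalDegree = n + 1 :=
    ⟨_, (Nat.succ_pred_eq_of_pos (he.trans (hP j))).symm⟩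
  have hlow := hC j z hz1
  have htop : δ * ‖z‖ ^ (n + 1) ≤
      ‖eval (fun t => z t) (homogeneousComponent (P j).totalDegree (P j))‖ := by
    have hhom := (homogeneousComponent_isHomogeneous (P j).totalDegree (P j)).eval_smul
      (‖z‖⁻¹ : ℂ) (fun t => z t)
    have hfun : (fun t => ((‖z‖⁻¹ : ℂ) • z) t) = (‖z‖⁻¹ : ℂ) • fun t => z t := rfl
    rw [hfun, hhom, norm_mul, norm_pow, norm_inv, Complex.norm_real, norm_norm, inv_pow] at hj
    rw [← hn, mul_comm]
    rwa [← le_inv_mul_iff₀ (by positivity)]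
  have hCj : C j ≤ ∑ j, C j := Finset.single_le_sum (fun i _ => hC0 i) (Finset.mem_univ j)
  have hCz : C j ≤ δ / 2 * ‖z‖ := by
    have : 2 * (∑ j, C j) / δ ≤ ‖z‖ := by linarith
    rw [div_le_iff₀ hδ] at this
    linarith
  rw [map_sub, hn, Nat.add_sub_cancel] at hlow
  rw [hn] at htop
  have htri := norm_sub_norm_le
    (eval (fun t => z t) (homogeneousComponent (n + 1) (P j))) (eval (fun t => z t) (P j))
  rw [norm_sub_rev] at htri
  have hpow : ‖z‖ ^ e ≤ ‖z‖ ^ (n + 1) := pow_le_pow_right₀ hz1 (hn ▸ hP j)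
  have hCp : C j * ‖z‖ ^ n ≤ δ / 2 * ‖z‖ ^ (n + 1) := by
    rw [pow_succ', ← mul_assoc]
    gcongr
  calc δ / 2 * ‖z‖ ^ e ≤ δ / 2 * ‖z‖ ^ (n + 1) := by gcongr
    _ ≤ ‖eval (fun t => z t) (P j)‖ := by linarith

theorem exists_norm_map_le {k : ℕ} (P : Fin k → MvPolynomial (Fin k) ℂ)
    (f : EuclideanSpace ℂ (Fin k) → EuclideanSpace ℂ (Fin k))
    (hf : ∀ z j, f z j = eval (fun t => z t) (P j)) :
    ∃ (C : ℝ) (n : ℕ), 0 ≤ C ∧ ∀ z, 1 ≤ ‖z‖ → ‖f z‖ ≤ C * ‖z‖ ^ n := by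
  choose C hC0 hC using fun j => exists_norm_eval_le (n := ∑ i, (P i).totalDegree) (P j)
    (fun s hs => (le_totalDegree hs).trans
      (Finset.single_le_sum (f := fun i => (P i).totalDegree)
        (fun i _ => Nat.zero_le _) (Finset.mem_univ j)))
  refine ⟨∑ j, C j, ∑ i, (P i).totalDegree, Finset.sum_nonneg fun j _ => hC0 j, fun z hz => ?_⟩
  have hsum : ‖f z‖ ≤ ∑ j, ‖f z j‖ := by
    rw [EuclideanSpace.norm_eq]
    refine Real.sqrt_le_iff.mpr ⟨Finset.sum_nonneg fun j _ => norm_nonneg _, ?_⟩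
    exact Finset.sum_sq_le_sq_sum_of_nonneg fun j _ => norm_nonneg _
  rw [Finset.sum_mul]
  refine hsum.trans (Finset.sum_le_sum fun j _ => ?_)
  rw [hf]
  exact hC j z hz

end MvPolynomial

theorem exists_block_of_lt {l : ℕ → ℕ} (hl0 : l 0 = 0) {m j : ℕ} (hj : j < l m) :
    ∃ i, 1 ≤ i ∧ i ≤ m ∧ l (i - 1) ≤ j ∧ j < l i := by
  classical
  have hex : ∃ i, j < l i := ⟨m, hj⟩
  have hpos : 1 ≤ Nat.find hex := by
    rw [Nat.one_le_iff_ne_zero, Ne, Nat.find_eq_zero]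
    omega
  exact ⟨Nat.find hex, hpos, Nat.find_min' hex hj,
    not_lt.mp (Nat.find_min hex (by omega)), Nat.find_spec hex⟩

/-- A power lower bound outside a ball and a power upper bound outside the unit ball compare the
exponents. -/
theorem le_of_rpow_le_norm_le_pow {E F : Type*} [NormedAddCommGroup E] [NormedSpace ℝ E]
    [Nontrivial E] [NormedAddCommGroup F] {f : E → F} {c C R lam : ℝ} {n : ℕ} (hc : 0 < c)
    (hlow : ∀ z, R ≤ ‖z‖ → c * ‖z‖ ^ lam ≤ ‖f z‖)
    (hup : ∀ z, 1 ≤ ‖z‖ → ‖f z‖ ≤ C * ‖z‖ ^ n) : lam ≤ n := by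
  by_contra! hlt
  have htend := tendsto_rpow_atTop (sub_pos.mpr hlt)
  obtain ⟨r, hr, hr1⟩ := ((htend.eventually_gt_atTop (C / c)).and
    (eventually_ge_atTop (max 1 R))).exists
  obtain ⟨z, hz⟩ := exists_norm_eq E
    (zero_le_one.trans ((le_max_left _ _).trans hr1))
  have hr0 : 0 < r := zero_lt_one.trans_le ((le_max_left _ _).trans hr1)
  have h := (hlow z (by rw [hz]; exact (le_max_right _ _).trans hr1)).trans
    (hup z (by rw [hz]; exact (le_max_left _ _).trans hr1))
  rw [hz] at h
  rw [Real.rpow_sub hr0, Real.rpow_natCast, div_lt_div_iff₀ hc (by positivity)] at hr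
  linarith

/-- If the top homogeneous parts of all coordinates of `f` have no
common zero except `0` (which holds whenever `f` is regular), then
`‖f z‖ ≥ c‖z‖^{d_m}` for large `‖z‖`; in particular `f` is proper and its
Łojasiewicz exponent is at least `d_m`. -/
theorem stmt4 (k m : ℕ) (hk : 0 < k) (hm : 1 ≤ m)
    (l : ℕ → ℕ) (hl0 : l 0 = 0) (hlm : l m = k)
    (hlmono : ∀ i < m, l i < l (i + 1))
    (P : Fin k → MvPolynomial (Fin k) ℂ)
    (d : ℕ → ℕ)
    (hdeg : ∀ i, 1 ≤ i → i ≤ m → ∀ j : Fin k,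
      l (i - 1) ≤ (j : ℕ) → (j : ℕ) < l i → (P j).totalDegree = d i)
    (hdmono : ∀ i, 1 ≤ i → i < m → d (i + 1) < d i)
    (hdm : 1 ≤ d m)
    (f : EuclideanSpace ℂ (Fin k) → EuclideanSpace ℂ (Fin k))
    (hf : ∀ (z : EuclideanSpace ℂ (Fin k)) (j : Fin k),
      f z j = eval (fun t => z t) (P j))
    (hreg : ∀ z : Fin k → ℂ,
      (∀ j : Fin k, eval z (pPlus k P j) = 0) → z = 0) :
    (∃ c R : ℝ, 0 < c ∧ 0 < R ∧ ∀ z : EuclideanSpace ℂ (Fin k),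
      R ≤ ‖z‖ → c * ‖z‖ ^ (d m : ℝ) ≤ ‖f z‖) ∧
    IsProperMap f ∧
    (d m : ℝ) ≤ sSup {lam : ℝ | 0 < lam ∧ ∃ c : ℝ, 0 < c ∧ ∃ R : ℝ,
      ∀ z : EuclideanSpace ℂ (Fin k), R ≤ ‖z‖ → c * ‖z‖ ^ lam ≤ ‖f z‖} := by
  have hP : ∀ j, d m ≤ (P j).totalDegree := by
    intro j
    obtain ⟨i, hi1, him, hij, hji⟩ := exists_block_of_lt hl0 (m := m) (j := j) (by omega)
    rw [hdeg i hi1 him j hij hji]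
    exact Nat.decreasingInduction' (P := fun i => d m ≤ d i)
      (fun a ham hia h => h.trans (hdmono a (hi1.trans hia) ham).le) him le_rfl
  obtain ⟨c, R, hc, hR, hlow⟩ := exists_le_norm_eval_of_top P hdm hP hreg
  have hbound : ∀ z, R ≤ ‖z‖ → c * ‖z‖ ^ (d m : ℝ) ≤ ‖f z‖ := by
    intro z hz
    obtain ⟨j, hj⟩ := hlow z hz
    rw [Real.rpow_natCast]
    refine hj.trans ?_
    rw [← hf]
    exact PiLp.norm_apply_le (f z) j
  have hdm0 : (0 : ℝ) < d m := by exact_mod_cast hdm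
  refine ⟨⟨c, R, hc, zero_lt_one.trans_le hR, hbound⟩, ?_, ?_⟩
  · have hcont : Continuous f := by
      refine (PiLp.continuous_toLp 2 _).comp (continuous_pi (f := fun z j => f z j) fun j => ?_)
      simp only [hf]
      exact continuous_eval_euclideanSpace (P j)
    refine isProperMap_iff_tendsto_cocompact.mpr ⟨hcont, ?_⟩
    rw [← Metric.cobounded_eq_cocompact, ← tendsto_norm_atTop_iff_cobounded]
    have hnorm : Tendsto (fun z : EuclideanSpace ℂ (Fin k) => ‖z‖)
        (Bornology.cobounded _) atTop := tendsto_norm_cobounded_atTop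
    exact tendsto_atTop_mono' _ ((hnorm.eventually_ge_atTop R).mono hbound)
      (((tendsto_rpow_atTop hdm0).comp hnorm).const_mul_atTop hc)
  · obtain ⟨C, n, -, hup⟩ := exists_norm_map_le P f hf
    have : Nonempty (Fin k) := ⟨⟨0, hk⟩⟩
    refine le_csSup ⟨n, ?_⟩ ⟨hdm0, c, hc, R, hbound⟩
    rintro lam ⟨-, c', hc', R', hlow'⟩
    exact le_of_rpow_le_norm_le_pow hc' hlow' hup
end

section
/- Assume f is proper and s-regular, let 1 ≤ i ≤ s, and assume i < m or d_m ≥ 2. Then there exist constants 0 < c ≤ c′, R₀ > 0 and ε₀ > 0 such that every z ∈ K_{i−1} with |z| ≥ R₀ and dist(z/|z|, Σ_i) ≤ ε₀ satisfies c·|z|^{d_i} ≤ |f_{(i)}(z)| ≤ c′·|z|^{d_i} and c·|z|^{d_i} ≤ |f(z)| ≤ c′·|z|^{d_i}; moreover, for every δ > 0 there exist R > 0 and ε > 0 such that every z ∈ K_{i−1} with |z| ≥ R and dist(z/|z|, Σ_i) ≤ ε satisfies |f_{(>i)}(z)| ≤ δ·|z|^{d_i}. -/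
open MvPolynomial Filter Topology Metric Set

/-- The endomorphism of the polynomial ring that kills the variables of index `< n`. -/
noncomputable def killVars (k n : ℕ) :
    MvPolynomial (Fin k) ℂ →ₐ[ℂ] MvPolynomial (Fin k) ℂ :=
  aeval fun j => if (j : ℕ) < n then 0 else X j

theorem killVars_killVars (k n : ℕ) (p : MvPolynomial (Fin k) ℂ) :
    killVars k (n + 1) (killVars k n p) = killVars k (n + 1) p := by
  have : (killVars k (n + 1)).comp (killVars k n) = killVars k (n + 1) := by
    ext1 j
    simp only [killVars, AlgHom.comp_apply, aeval_X]
    by_cases h : (j : ℕ) < n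
    · simp [h, Nat.lt_succ_of_lt h]
    · simp [h]
  exact DFunLike.congr_fun this p

theorem le_height_ker_killVars (k n : ℕ) (hn : n ≤ k) :
    (n : ℕ∞) ≤ (RingHom.ker (killVars k n)).height := by
  induction n with
  | zero => simp
  | succ n ih =>
    have hlt : RingHom.ker (killVars k n) < RingHom.ker (killVars k (n + 1)) := by
      refine lt_of_le_of_ne (fun p hp => ?_) fun h => ?_
      · rw [RingHom.mem_ker] at hp ⊢
        rw [← killVars_killVars, hp, map_zero]
      · have hX : X (⟨n, hn⟩ : Fin k) ∈ RingHom.ker (killVars k (n + 1)) := by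
          simp [RingHom.mem_ker, killVars]
        rw [← h] at hX
        simp [RingHom.mem_ker, killVars] at hX
    have := RingHom.ker_isPrime (killVars k n)
    have := RingHom.ker_isPrime (killVars k (n + 1))
    have h := Ideal.height_add_one_le_of_lt_of_isPrime hlt
    push_cast
    exact (add_le_add_left (ih (by omega)) 1).trans h

theorem ker_killVars_self (k : ℕ) :
    RingHom.ker (killVars k k) = vanishingIdeal ℂ {(0 : Fin k → ℂ)} := by
  ext p
  have : killVars k k = (Algebra.ofId ℂ _).comp (aeval (0 : Fin k → ℂ)) := by
    ext1 j
    simp [killVars]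
  rw [RingHom.mem_ker, mem_vanishingIdeal_singleton_iff, this]
  simp [Algebra.ofId_apply]

/-- Fewer than `k` polynomials in `k` variables that vanish at the origin have a further common
zero. -/
theorem exists_ne_zero_common_zero {k : ℕ} (T : Finset (MvPolynomial (Fin k) ℂ))
    (hT : T.card < k) (h0 : ∀ p ∈ T, eval 0 p = 0) :
    ∃ w : Fin k → ℂ, w ≠ 0 ∧ ∀ p ∈ T, eval w p = 0 := by
  by_contra! hne
  have hloc : zeroLocus ℂ (Ideal.span (T : Set (MvPolynomial (Fin k) ℂ))) = {0} := by
    rw [zeroLocus_span]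
    ext w
    simp only [Finset.mem_coe, aeval_eq_eval, Set.mem_ofPred_eq, Set.mem_singleton_iff]
    refine ⟨fun h => ?_, ?_⟩
    · by_contra hw
      obtain ⟨p, hp, hp'⟩ := hne w hw
      exact hp' (h p hp)
    · rintro rfl
      exact h0
  have hrad := vanishingIdeal_zeroLocus_eq_radical (K := ℂ)
    (Ideal.span (T : Set (MvPolynomial (Fin k) ℂ)))
  rw [hloc] at hrad
  have hmin : vanishingIdeal ℂ {(0 : Fin k → ℂ)} ∈
      (Ideal.span (T : Set (MvPolynomial (Fin k) ℂ))).minimalPrimes := by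
    rw [← Ideal.radical_minimalPrimes, ← hrad, Ideal.minimalPrimes_eq_subsingleton_self]
    rfl
  have h1 := Ideal.height_le_card_of_mem_minimalPrimes_span_finset hmin
  have h2 := le_height_ker_killVars k k le_rfl
  rw [ker_killVars_self] at h2
  have h3 : (k : ℕ∞) ≤ T.card := h2.trans h1
  exact absurd (by exact_mod_cast h3) (not_le.2 hT)

/-- A polynomial of total degree at most `n` grows at most like `‖z‖ ^ n`. -/
theorem exists_norm_eval_le {k : ℕ} (p : MvPolynomial (Fin k) ℂ) (n : ℕ)
    (hp : p.totalDegree ≤ n) :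
    ∃ C : ℝ, 0 ≤ C ∧ ∀ z : EuclideanSpace ℂ (Fin k), 1 ≤ ‖z‖ →
      ‖eval (fun t => z t) p‖ ≤ C * ‖z‖ ^ n := by
  refine ⟨∑ e ∈ p.support, ‖coeff e p‖, by positivity, fun z hz => ?_⟩
  rw [eval_eq', Finset.sum_mul]
  refine (norm_sum_le _ _).trans (Finset.sum_le_sum fun e he => ?_)
  rw [norm_mul, norm_prod]
  gcongr
  calc ∏ t, ‖z t ^ e t‖ ≤ ∏ t, ‖z‖ ^ e t := by
        gcongr with t
        rw [norm_pow]
        gcongr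
        exact PiLp.norm_apply_le z t
    _ = ‖z‖ ^ (∑ t, e t) := Finset.prod_pow_eq_pow_sum _ _ _
    _ ≤ ‖z‖ ^ n := by
        refine pow_le_pow_right₀ hz (le_trans ?_ hp)
        have := le_totalDegree he
        rwa [Finsupp.sum_fintype _ _ fun _ => rfl] at this

theorem norm_eval_normalize {k n : ℕ} {q : MvPolynomial (Fin k) ℂ} (hq : q.IsHomogeneous n)
    {z : EuclideanSpace ℂ (Fin k)} (hz : z ≠ 0) :
    ‖eval (fun t => (‖z‖⁻¹ • z) t) q‖ * ‖z‖ ^ n = ‖eval (fun t => z t) q‖ := by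
  have hz' : ‖z‖ ≠ 0 := norm_ne_zero_iff.2 hz
  have h : eval (fun t => (‖z‖⁻¹ • z) t) q = ((‖z‖⁻¹ : ℝ) : ℂ) ^ n * eval (fun t => z t) q := by
    rw [eval_eq', eval_eq', Finset.mul_sum]
    refine Finset.sum_congr rfl fun e he => ?_
    have hdeg : ∑ t, e t = n := by
      rw [← Finsupp.degree_eq_sum, Finsupp.degree_eq_weight_one]
      exact hq (mem_support_iff.1 he)
    simp only [PiLp.smul_apply, Complex.real_smul, mul_pow, Finset.prod_mul_distrib,
      Finset.prod_pow_eq_pow_sum, hdeg]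
    ring
  rw [h, norm_mul, norm_pow, Complex.norm_real, norm_inv, norm_norm, mul_right_comm, ← mul_pow,
    inv_mul_cancel₀ hz', one_pow, one_mul]

/-- The top homogeneous part, evaluated in the direction of `z`, is controlled by the value of the
polynomial at `z` up to a lower order term. -/
theorem exists_norm_top_mul_le {k : ℕ} (p : MvPolynomial (Fin k) ℂ) :
    ∃ C : ℝ, 0 ≤ C ∧ ∀ z : EuclideanSpace ℂ (Fin k), 1 ≤ ‖z‖ →
      ‖eval (fun t => (‖z‖⁻¹ • z) t) (homogeneousComponent p.totalDegree p)‖ *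
        ‖z‖ ^ p.totalDegree ≤ ‖eval (fun t => z t) p‖ + C * ‖z‖ ^ (p.totalDegree - 1) := by
  set q := ∑ i ∈ Finset.range p.totalDegree, homogeneousComponent i p with hq
  have hpq : q + homogeneousComponent p.totalDegree p = p := by
    rw [hq, ← Finset.sum_range_succ, sum_homogeneousComponent]
  have hqd : q.totalDegree ≤ p.totalDegree - 1 := by
    refine totalDegree_finsetSum_le fun i hi => ?_
    have := (homogeneousComponent_isHomogeneous i p).totalDegree_le
    have := Finset.mem_range.1 hi
    omega
  obtain ⟨C, hC0, hC⟩ := exists_norm_eval_le q _ hqd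
  refine ⟨C, hC0, fun z hz => ?_⟩
  have hz0 : z ≠ 0 := norm_pos_iff.1 (by linarith)
  rw [norm_eval_normalize (homogeneousComponent_isHomogeneous _ p) hz0]
  have h : eval (fun t => z t) (homogeneousComponent p.totalDegree p) =
      eval (fun t => z t) p - eval (fun t => z t) q := by
    rw [← map_sub, sub_eq_of_eq_add' hpq.symm]
  rw [h]
  exact (norm_sub_le _ _).trans (by gcongr; exact hC z hz)

section Compactness

variable {E V : Type*} [MetricSpace E] [NormedAddCommGroup V]

theorem IsCompact.exists_pos_le_norm {S : Set E} (hS : IsCompact S) {F : E → V}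
    (hF : Continuous F) (h : ∀ w ∈ S, F w ≠ 0) : ∃ c > 0, ∀ w ∈ S, c ≤ ‖F w‖ :=
  hS.exists_forall_le' hF.norm.continuousOn fun w hw => norm_pos_iff.2 (h w hw)

theorem IsCompact.exists_infDist_zeros_le {S : Set E} (hS : IsCompact S) {F : E → V}
    (hF : Continuous F) {η : ℝ} (hη : 0 < η) :
    ∃ δ > 0, ∀ w ∈ S, ‖F w‖ ≤ δ → infDist w {v | v ∈ S ∧ F v = 0} ≤ η := by
  have hS' : IsCompact (S ∩ {w | η ≤ infDist w {v | v ∈ S ∧ F v = 0}}) :=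
    hS.inter_right (isClosed_le continuous_const (continuous_infDist_pt _))
  obtain ⟨c, hc, h⟩ := hS'.exists_pos_le_norm hF fun w hw h0 => by
    have hw' : η ≤ infDist w {v | v ∈ S ∧ F v = 0} := hw.2
    rw [infDist_zero_of_mem (show w ∈ {v | v ∈ S ∧ F v = 0} from ⟨hw.1, h0⟩)] at hw'
    exact absurd hw' (not_le.2 hη)
  refine ⟨c / 2, half_pos hc, fun w hw hle => ?_⟩
  by_contra! hlt
  have := h w ⟨hw, hlt.le⟩
  linarith

theorem IsCompact.exists_le_norm_of_infDist_le {S Z : Set E} (hS : IsCompact S)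
    (hZ : IsClosed Z) (hne : Z.Nonempty) {F : E → V} (hF : Continuous F)
    (h : ∀ w ∈ Z, F w ≠ 0) :
    ∃ c > 0, ∀ w ∈ S, infDist w Z ≤ c → c ≤ ‖F w‖ := by
  obtain ⟨c, hc, hle⟩ := hS.exists_forall_le' (f := fun w => infDist w Z + ‖F w‖) (a := 0)
    ((continuous_infDist_pt Z).add hF.norm).continuousOn fun w _ => by
      rcases (infDist_nonneg (x := w) (s := Z)).eq_or_lt with h0 | h0
      · have := norm_pos_iff.2 (h w ((hZ.mem_iff_infDist_zero hne).2 h0.symm))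
        positivity
      · positivity
  refine ⟨c / 2, half_pos hc, fun w hw hd => ?_⟩
  have := hle w hw
  linarith

end Compactness

/-- The equations of the cone over `Σ`: the top homogeneous parts of the coordinates of index
`< a`, and the coordinates of index `≥ b`. -/
noncomputable def coneEqs (k : ℕ) (P : Fin k → MvPolynomial (Fin k) ℂ) (a b : ℕ)
    (w : EuclideanSpace ℂ (Fin k)) (j : Fin k) : ℂ :=
  if (j : ℕ) < a then eval (fun t => w t) (pPlus k P j) else if b ≤ (j : ℕ) then w j else 0

theorem continuous_eval_coords {k : ℕ} (p : MvPolynomial (Fin k) ℂ) :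
    Continuous fun w : EuclideanSpace ℂ (Fin k) => eval (fun t => w t) p :=
  (MvPolynomial.continuous_eval p).comp (by fun_prop)

theorem continuous_coneEqs (k : ℕ) (P : Fin k → MvPolynomial (Fin k) ℂ) (a b : ℕ) :
    Continuous (coneEqs k P a b) := by
  refine continuous_pi fun j => ?_
  unfold coneEqs
  split_ifs
  · exact continuous_eval_coords _
  · fun_prop
  · fun_prop

theorem coneEqs_eq_zero_iff {k : ℕ} {P : Fin k → MvPolynomial (Fin k) ℂ} {a b : ℕ} (hab : a ≤ b)
    {w : EuclideanSpace ℂ (Fin k)} :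
    coneEqs k P a b w = 0 ↔ (∀ j : Fin k, (j : ℕ) < a → eval (fun t => w t) (pPlus k P j) = 0) ∧
      ∀ j : Fin k, b ≤ (j : ℕ) → w j = 0 := by
  refine ⟨fun h => ⟨fun j hj => ?_, fun j hj => ?_⟩, fun h => ?_⟩
  · simpa [coneEqs, hj] using congrFun h j
  · simpa [coneEqs, hj, not_lt.2 (hab.trans hj)] using congrFun h j
  · ext j
    unfold coneEqs
    split_ifs with h1 h2
    exacts [h.1 j h1, h.2 j h2, rfl]

theorem sigmaSet_eq_zeros {k : ℕ} (P : Fin k → MvPolynomial (Fin k) ℂ) {l : ℕ → ℕ} {r : ℕ}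
    (hl : l (r - 1) ≤ l r) :
    sigmaSet k P l r = {w | w ∈ sphere (0 : EuclideanSpace ℂ (Fin k)) 1 ∧
      coneEqs k P (l (r - 1)) (l r) w = 0} := by
  ext w
  simp only [sigmaSet, Set.mem_ofPred_eq, mem_sphere_zero_iff_norm, coneEqs_eq_zero_iff hl]

theorem normalize_mem_sphere {E : Type*} [NormedAddCommGroup E] [NormedSpace ℝ E] {z : E}
    (hz : z ≠ 0) : ‖z‖⁻¹ • z ∈ sphere (0 : E) 1 := by
  rw [mem_sphere_zero_iff_norm, norm_smul, norm_inv, norm_norm,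
    inv_mul_cancel₀ (norm_ne_zero_iff.2 hz)]

theorem norm_normalize_apply {k : ℕ} (z : EuclideanSpace ℂ (Fin k)) (j : Fin k) :
    ‖(‖z‖⁻¹ • z) j‖ = ‖z j‖ / ‖z‖ := by
  rw [PiLp.smul_apply, norm_smul, norm_inv, norm_norm, inv_mul_eq_div]

theorem iterate_mem_basin {k : ℕ} {f : EuclideanSpace ℂ (Fin k) → EuclideanSpace ℂ (Fin k)}
    {P : Fin k → MvPolynomial (Fin k) ℂ} {l : ℕ → ℕ} {r n : ℕ} {z : EuclideanSpace ℂ (Fin k)}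
    (h : f^[n] z ∈ basin k f P l r) : z ∈ basin k f P l r := by
  have hit : ∀ q, f^[q] (f^[n] z) = f^[q + n] z := fun q => (Function.iterate_add_apply f q n z).symm
  obtain ⟨h1, h2⟩ := h
  simp only [hit] at h1 h2
  exact ⟨(tendsto_add_atTop_iff_nat (f := fun q => ‖f^[q] z‖) n).1 h1,
    (tendsto_add_atTop_iff_nat
      (f := fun q => infDist (‖f^[q] z‖⁻¹ • f^[q] z) (sigmaSet k P l r)) n).1 h2⟩

section Growth

variable {k : ℕ} {P : Fin k → MvPolynomial (Fin k) ℂ}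
  {f : EuclideanSpace ℂ (Fin k) → EuclideanSpace ℂ (Fin k)}

theorem exists_norm_apply_le
    (hf : ∀ (z : EuclideanSpace ℂ (Fin k)) (j : Fin k), f z j = eval (fun t => z t) (P j)) :
    ∃ C : ℝ, 0 < C ∧ ∀ z : EuclideanSpace ℂ (Fin k), 1 ≤ ‖z‖ → ∀ j (n : ℕ),
      (P j).totalDegree ≤ n → ‖f z j‖ ≤ C * ‖z‖ ^ n := by
  choose C hC0 hC using fun j => exists_norm_eval_le (P j) _ le_rfl
  have hsum : 0 ≤ ∑ j, C j := Finset.sum_nonneg fun j _ => hC0 j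
  refine ⟨∑ j, C j + 1, by linarith, fun z hz j n hn => ?_⟩
  rw [hf]
  have hj : C j ≤ ∑ j, C j + 1 := by
    have := Finset.single_le_sum (fun j _ => hC0 j) (Finset.mem_univ j)
    linarith
  calc _ ≤ C j * ‖z‖ ^ (P j).totalDegree := hC j z hz
    _ ≤ _ := by gcongr

theorem exists_norm_pPlus_mul_le
    (hf : ∀ (z : EuclideanSpace ℂ (Fin k)) (j : Fin k), f z j = eval (fun t => z t) (P j)) :
    ∃ C : ℝ, 0 < C ∧ ∀ z : EuclideanSpace ℂ (Fin k), 1 ≤ ‖z‖ → ∀ j,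
      ‖eval (fun t => (‖z‖⁻¹ • z) t) (pPlus k P j)‖ * ‖z‖ ^ (P j).totalDegree ≤
        ‖f z j‖ + C * ‖z‖ ^ ((P j).totalDegree - 1) := by
  choose C hC0 hC using fun j => exists_norm_top_mul_le (P j)
  have hsum : 0 ≤ ∑ j, C j := Finset.sum_nonneg fun j _ => hC0 j
  refine ⟨∑ j, C j + 1, by linarith, fun z hz j => ?_⟩
  rw [hf]
  have hj : C j ≤ ∑ j, C j + 1 := by
    have := Finset.single_le_sum (fun j _ => hC0 j) (Finset.mem_univ j)
    linarith
  refine (hC j z hz).trans ?_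
  gcongr

/-- Where the top homogeneous part of a coordinate is bounded below, so is the coordinate. -/
theorem exists_le_norm_apply
    (hf : ∀ (z : EuclideanSpace ℂ (Fin k)) (j : Fin k), f z j = eval (fun t => z t) (P j))
    {c : ℝ} (hc : 0 < c) :
    ∃ R : ℝ, 1 ≤ R ∧ ∀ z : EuclideanSpace ℂ (Fin k), R ≤ ‖z‖ → ∀ j (n : ℕ), 1 ≤ n →
      n ≤ (P j).totalDegree → c ≤ ‖eval (fun t => (‖z‖⁻¹ • z) t) (pPlus k P j)‖ →
      c / 2 * ‖z‖ ^ n ≤ ‖f z j‖ := by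
  obtain ⟨C, hC0, hC⟩ := exists_norm_pPlus_mul_le hf
  refine ⟨max 1 (2 * C / c), le_max_left _ _, fun z hz j n hn1 hn hcj => ?_⟩
  have hz1 : 1 ≤ ‖z‖ := (le_max_left _ _).trans hz
  have hz2 : 2 * C ≤ ‖z‖ * c := (div_le_iff₀ hc).1 ((le_max_right _ _).trans hz)
  obtain ⟨q, hq⟩ : ∃ q, (P j).totalDegree = q + 1 := ⟨_, (Nat.sub_add_cancel (hn1.trans hn)).symm⟩
  have h := hC z hz1 j
  rw [hq, Nat.add_sub_cancel] at h
  have h1 : c * ‖z‖ ^ (q + 1) ≤ ‖f z j‖ + C * ‖z‖ ^ q :=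
    le_trans (by gcongr) h
  have h2 : c / 2 * ‖z‖ ^ n ≤ c / 2 * ‖z‖ ^ (q + 1) := by
    gcongr
    exact hn.trans hq.le
  have h3 : C * ‖z‖ ^ q ≤ c / 2 * ‖z‖ ^ (q + 1) := by
    rw [pow_succ, mul_comm (‖z‖ ^ q), ← mul_assoc]
    gcongr
    linarith
  linarith

/-- Expansion near the linear subspace where the coordinates of index `≥ b` vanish. -/
theorem exists_le_norm_of_near
    (hf : ∀ (z : EuclideanSpace ℂ (Fin k)) (j : Fin k), f z j = eval (fun t => z t) (P j))
    {b e : ℕ} (he : 1 ≤ e) (hDlow : ∀ j : Fin k, (j : ℕ) < b → e ≤ (P j).totalDegree)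
    (hreg : ∀ z : Fin k → ℂ, (∀ j : Fin k, (j : ℕ) < b → eval z (pPlus k P j) = 0) →
      (∀ j : Fin k, b ≤ (j : ℕ) → z j = 0) → z = 0) :
    ∃ c R ε : ℝ, 0 < c ∧ 1 ≤ R ∧ 0 < ε ∧ ∀ z : EuclideanSpace ℂ (Fin k), R ≤ ‖z‖ →
      (∀ j : Fin k, b ≤ (j : ℕ) → ‖z j‖ ≤ ε * ‖z‖) → c * ‖z‖ ^ e ≤ ‖f z‖ := by
  obtain ⟨c, hc, hle⟩ := (isCompact_sphere (0 : EuclideanSpace ℂ (Fin k)) 1).exists_pos_le_norm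
    (continuous_coneEqs k P b b) fun w hw h0 => by
      obtain ⟨h1, h2⟩ := (coneEqs_eq_zero_iff le_rfl).1 h0
      have hw0 : w = 0 := by
        ext j
        exact congrFun (hreg (fun t => w t) h1 h2) j
      simp [hw0] at hw
  obtain ⟨R, hR, hlow⟩ := exists_le_norm_apply hf hc
  refine ⟨c / 2, R, c / 2, half_pos hc, hR, half_pos hc, fun z hz hnear => ?_⟩
  have hzpos : 0 < ‖z‖ := by linarith
  have hnorm := hle _ (normalize_mem_sphere (norm_pos_iff.1 hzpos))
  obtain ⟨j, hj⟩ : ∃ j, c ≤ ‖coneEqs k P b b (‖z‖⁻¹ • z) j‖ := by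
    by_contra! hlt
    exact absurd ((pi_norm_lt_iff hc).2 hlt) (not_lt.2 hnorm)
  by_cases hjb : (j : ℕ) < b
  · rw [coneEqs, if_pos hjb] at hj
    exact (hlow z hz j e he (hDlow j hjb) hj).trans (PiLp.norm_apply_le (f z) j)
  · rw [coneEqs, if_neg hjb, if_pos (not_lt.1 hjb), norm_normalize_apply, le_div_iff₀ hzpos] at hj
    have := hnear j (not_lt.1 hjb)
    nlinarith

/-- A neighbourhood at infinity of the linear subspace where the coordinates of index `≥ b` vanish
is trapping. -/
theorem exists_trapping
    (hf : ∀ (z : EuclideanSpace ℂ (Fin k)) (j : Fin k), f z j = eval (fun t => z t) (P j))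
    {b e : ℕ} (he : 2 ≤ e) (hDlow : ∀ j : Fin k, (j : ℕ) < b → e ≤ (P j).totalDegree)
    (hDup : ∀ j : Fin k, b ≤ (j : ℕ) → (P j).totalDegree + 1 ≤ e)
    (hreg : ∀ z : Fin k → ℂ, (∀ j : Fin k, (j : ℕ) < b → eval z (pPlus k P j) = 0) →
      (∀ j : Fin k, b ≤ (j : ℕ) → z j = 0) → z = 0) :
    ∃ R ε M : ℝ, 1 ≤ R ∧ 0 < ε ∧ ∀ z : EuclideanSpace ℂ (Fin k), R ≤ ‖z‖ →
      (∀ j : Fin k, b ≤ (j : ℕ) → ‖z j‖ ≤ ε * ‖z‖) → 2 * ‖z‖ ≤ ‖f z‖ ∧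
        ∀ j : Fin k, b ≤ (j : ℕ) → ‖f z j‖ ≤ ε * ‖f z‖ ∧ ‖f z j‖ / ‖f z‖ ≤ M / ‖z‖ := by
  obtain ⟨c, R, ε, hc, hR, hε, hlow⟩ := exists_le_norm_of_near hf (by omega) hDlow hreg
  obtain ⟨C, hC0, hC⟩ := exists_norm_apply_le hf
  refine ⟨max R (max (2 / c) (C / c / ε)), ε, C / c, hR.trans (le_max_left _ _), hε,
    fun z hz hnear => ?_⟩
  have hz1 : R ≤ ‖z‖ := (le_max_left _ _).trans hz
  have hz2 : 2 ≤ ‖z‖ * c :=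
    (div_le_iff₀ hc).1 (((le_max_left _ _).trans (le_max_right _ _)).trans hz)
  have hz3 : C / c ≤ ‖z‖ * ε :=
    (div_le_iff₀ hε).1 (((le_max_right _ _).trans (le_max_right _ _)).trans hz)
  have hz4 : 1 ≤ ‖z‖ := hR.trans hz1
  have hzpos : 0 < ‖z‖ := by linarith
  have hfz := hlow z hz1 hnear
  obtain ⟨q, rfl⟩ : ∃ q, e = q + 2 := ⟨_, (Nat.sub_add_cancel he).symm⟩
  have hgrow : 2 * ‖z‖ ≤ ‖f z‖ := by
    have h1 : ‖z‖ ≤ ‖z‖ ^ (q + 1) := le_self_pow₀ hz4 (by omega)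
    calc 2 * ‖z‖ ≤ ‖z‖ * c * ‖z‖ ^ (q + 1) := by gcongr
      _ = c * ‖z‖ ^ (q + 2) := by ring
      _ ≤ _ := hfz
  have hfpos : 0 < ‖f z‖ := by linarith
  refine ⟨hgrow, fun j hj => ?_⟩
  have hquot : ‖f z j‖ / ‖f z‖ ≤ C / c / ‖z‖ := by
    have h1 := hC z hz4 j (q + 1) (by have := hDup j hj; omega)
    rw [div_div, div_le_div_iff₀ hfpos (by positivity)]
    calc ‖f z j‖ * (c * ‖z‖) ≤ C * ‖z‖ ^ (q + 1) * (c * ‖z‖) := by gcongr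
      _ = C * (c * ‖z‖ ^ (q + 2)) := by ring
      _ ≤ _ := by gcongr
  refine ⟨?_, hquot⟩
  rw [← div_le_iff₀ hfpos]
  refine hquot.trans ((div_le_iff₀ hzpos).2 ?_)
  linarith

/-- A point near the linear subspace where the coordinates of index `≥ l r` vanish either lies in
the `r`-th basin, or its orbit enters a given neighbourhood of the previous subspace. -/
theorem exists_mem_basin_or_near
    (hf : ∀ (z : EuclideanSpace ℂ (Fin k)) (j : Fin k), f z j = eval (fun t => z t) (P j))
    {l : ℕ → ℕ} {r e : ℕ} (hl : l (r - 1) ≤ l r) (he : 2 ≤ e)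
    (hDlow : ∀ j : Fin k, (j : ℕ) < l r → e ≤ (P j).totalDegree)
    (hDlow' : ∀ j : Fin k, (j : ℕ) < l (r - 1) → e + 1 ≤ (P j).totalDegree)
    (hDup : ∀ j : Fin k, l r ≤ (j : ℕ) → (P j).totalDegree + 1 ≤ e)
    (hDup' : ∀ j : Fin k, l (r - 1) ≤ (j : ℕ) → (P j).totalDegree ≤ e)
    (hreg : ∀ z : Fin k → ℂ, (∀ j : Fin k, (j : ℕ) < l r → eval z (pPlus k P j) = 0) →
      (∀ j : Fin k, l r ≤ (j : ℕ) → z j = 0) → z = 0)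
    (R' : ℝ) {ε' : ℝ} (hε' : 0 < ε') :
    ∃ R ε : ℝ, 0 < R ∧ 0 < ε ∧ ∀ z : EuclideanSpace ℂ (Fin k), R ≤ ‖z‖ →
      (∀ j : Fin k, l r ≤ (j : ℕ) → ‖z j‖ ≤ ε * ‖z‖) →
      z ∈ basin k f P l r ∨ ∃ n, R' ≤ ‖f^[n] z‖ ∧
        ∀ j : Fin k, l (r - 1) ≤ (j : ℕ) → ‖(f^[n] z) j‖ ≤ ε' * ‖f^[n] z‖ := by
  obtain ⟨R, ε, M, hR, hε, htrap⟩ := exists_trapping hf he hDlow hDup hreg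
  refine ⟨R, ε, by linarith, hε, fun z hz hnear => or_iff_not_imp_right.2 fun hnot => ?_⟩
  push Not at hnot
  have horb : ∀ n, R * 2 ^ n ≤ ‖f^[n] z‖ ∧
      ∀ j : Fin k, l r ≤ (j : ℕ) → ‖(f^[n] z) j‖ ≤ ε * ‖f^[n] z‖ := by
    intro n
    induction n with
    | zero => simpa using ⟨hz, hnear⟩
    | succ n ih =>
      have hRn : R ≤ ‖f^[n] z‖ :=
        (le_mul_of_one_le_right (by linarith) (one_le_pow₀ one_le_two)).trans ih.1
      obtain ⟨h1, h2⟩ := htrap _ hRn ih.2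
      rw [Function.iterate_succ_apply']
      refine ⟨?_, fun j hj => (h2 j hj).1⟩
      rw [pow_succ]
      linarith [ih.1]
  have hRn : ∀ n, R ≤ ‖f^[n] z‖ := fun n =>
    (le_mul_of_one_le_right (by linarith) (one_le_pow₀ one_le_two)).trans (horb n).1
  have htop : Tendsto (fun n => ‖f^[n] z‖) atTop atTop :=
    tendsto_atTop_mono (fun n => (horb n).1)
      ((tendsto_pow_atTop_atTop_of_one_lt one_lt_two).const_mul_atTop (by linarith))
  have hinv : ∀ A : ℝ, Tendsto (fun n => A / ‖f^[n] z‖) atTop (𝓝 0) := fun A =>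
    tendsto_const_nhds.div_atTop htop
  obtain ⟨C, hC0, hC⟩ := exists_norm_apply_le hf
  obtain ⟨C', hC0', hC'⟩ := exists_norm_pPlus_mul_le hf
  have heqs : Tendsto (fun n => coneEqs k P (l (r - 1)) (l r) (‖f^[n] z‖⁻¹ • f^[n] z))
      atTop (𝓝 0) := by
    refine tendsto_pi_nhds.2 fun j => ?_
    by_cases hja : (j : ℕ) < l (r - 1)
    · simp only [coneEqs, if_pos hja, Pi.zero_apply]
      refine squeeze_zero_norm' ?_ (hinv (C / ε' + C'))
      filter_upwards [((tendsto_add_atTop_iff_nat 1).2 htop).eventually_ge_atTop R'] with n hn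
      obtain ⟨i, hi, hlt⟩ := hnot (n + 1) hn
      rw [Function.iterate_succ_apply'] at hlt
      set x := f^[n] z
      have hx1 : 1 ≤ ‖x‖ := hR.trans (hRn n)
      have hxpos : 0 < ‖x‖ := by linarith
      obtain ⟨q, hq⟩ : ∃ q, (P j).totalDegree = q + 1 :=
        ⟨_, (Nat.sub_add_cancel (le_trans (by omega) (hDlow' j hja))).symm⟩
      have h1 : ‖f x i‖ ≤ C * ‖x‖ ^ q :=
        hC x hx1 i q (by have := hDup' i hi; have := hDlow' j hja; omega)
      have h2 : ‖f x‖ ≤ C / ε' * ‖x‖ ^ q := by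
        rw [div_mul_eq_mul_div, le_div_iff₀ hε']
        linarith
      have h3 := hC' x hx1 j
      rw [hq, Nat.add_sub_cancel, pow_succ', ← mul_assoc] at h3
      have h4 := PiLp.norm_apply_le (f x) j
      rw [le_div_iff₀ hxpos]
      refine le_of_mul_le_mul_right ?_ (pow_pos hxpos q)
      linarith
    · by_cases hjb : l r ≤ (j : ℕ)
      · simp only [coneEqs, if_neg hja, if_pos hjb, Pi.zero_apply]
        refine (tendsto_add_atTop_iff_nat 1).1 (squeeze_zero_norm (fun n => ?_) (hinv M))
        rw [norm_normalize_apply, Function.iterate_succ_apply']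
        exact ((htrap _ (hRn n) (horb n).2).2 j hjb).2
      · simp [coneEqs, hja, hjb]
  refine ⟨htop, tendsto_order.2 ⟨fun a ha => Eventually.of_forall fun n =>
    ha.trans_le infDist_nonneg, fun η hη => ?_⟩⟩
  obtain ⟨δ, hδ, hdist⟩ := (isCompact_sphere (0 : EuclideanSpace ℂ (Fin k))
    1).exists_infDist_zeros_le (continuous_coneEqs k P (l (r - 1)) (l r)) (half_pos hη)
  have hnorm := heqs.norm
  rw [norm_zero] at hnorm
  filter_upwards [hnorm.eventually_le_const hδ] with n hn
  rw [sigmaSet_eq_zeros P hl]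
  have hn0 : f^[n] z ≠ 0 := norm_pos_iff.1 (by linarith [hRn n])
  linarith [hdist _ (normalize_mem_sphere hn0) hn]

end Growth

section Blocks

variable {k m : ℕ} {l : ℕ → ℕ}

theorem block_le_of_le (hlmono : ∀ i < m, l i < l (i + 1)) {a b : ℕ} (hab : a ≤ b) (hb : b ≤ m) :
    l a ≤ l b := by
  induction b, hab using Nat.le_induction with
  | base => rfl
  | succ b _ ih => exact (ih (by omega)).trans (hlmono b (by omega)).le

theorem deg_le_of_le {d : ℕ → ℕ} (hdmono : ∀ i, 1 ≤ i → i < m → d (i + 1) < d i) {a b : ℕ}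
    (ha : 1 ≤ a) (hab : a ≤ b) (hb : b ≤ m) : d b ≤ d a := by
  induction b, hab using Nat.le_induction with
  | base => rfl
  | succ b hab ih => exact (hdmono b (by omega) (by omega)).le.trans (ih (by omega))

theorem exists_block (hl0 : l 0 = 0) (hlm : l m = k) (j : Fin k) :
    ∃ b, 1 ≤ b ∧ b ≤ m ∧ l (b - 1) ≤ (j : ℕ) ∧ (j : ℕ) < l b := by
  have hex : ∃ b, (j : ℕ) < l b := ⟨m, hlm ▸ j.2⟩
  have hpos : Nat.find hex ≠ 0 := fun h => by
    have := Nat.find_spec hex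
    simp [h, hl0] at this
  exact ⟨Nat.find hex, Nat.one_le_iff_ne_zero.2 hpos, Nat.find_min' hex (hlm ▸ j.2),
    not_lt.1 (Nat.find_min hex (Nat.sub_one_lt hpos)), Nat.find_spec hex⟩

theorem totalDegree_le_of_block_le (hl0 : l 0 = 0) (hlm : l m = k)
    (hlmono : ∀ i < m, l i < l (i + 1)) {P : Fin k → MvPolynomial (Fin k) ℂ} {d : ℕ → ℕ}
    (hdeg : ∀ i, 1 ≤ i → i ≤ m → ∀ j : Fin k,
      l (i - 1) ≤ (j : ℕ) → (j : ℕ) < l i → (P j).totalDegree = d i)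
    (hdmono : ∀ i, 1 ≤ i → i < m → d (i + 1) < d i) {r : ℕ} (hr : 1 ≤ r)
    (hrm : r ≤ m) {j : Fin k} (hj : l (r - 1) ≤ (j : ℕ)) : (P j).totalDegree ≤ d r := by
  obtain ⟨b, hb1, hbm, h1, h2⟩ := exists_block hl0 hlm j
  rw [hdeg b hb1 hbm j h1 h2]
  refine deg_le_of_le hdmono hr ?_ hbm
  by_contra! hlt
  have := block_le_of_le hlmono (a := b) (b := r - 1) (by omega) (by omega)
  omega

theorem le_totalDegree_of_lt_block (hl0 : l 0 = 0) (hlm : l m = k)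
    (hlmono : ∀ i < m, l i < l (i + 1)) {P : Fin k → MvPolynomial (Fin k) ℂ} {d : ℕ → ℕ}
    (hdeg : ∀ i, 1 ≤ i → i ≤ m → ∀ j : Fin k,
      l (i - 1) ≤ (j : ℕ) → (j : ℕ) < l i → (P j).totalDegree = d i)
    (hdmono : ∀ i, 1 ≤ i → i < m → d (i + 1) < d i) {r : ℕ}
    (hrm : r ≤ m) {j : Fin k} (hj : (j : ℕ) < l r) : d r ≤ (P j).totalDegree := by
  obtain ⟨b, hb1, hbm, h1, h2⟩ := exists_block hl0 hlm j
  rw [hdeg b hb1 hbm j h1 h2]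
  refine deg_le_of_le hdmono hb1 ?_ hrm
  by_contra! hlt
  have := block_le_of_le hlmono (a := r) (b := b - 1) (by omega) (by omega)
  omega

theorem totalDegree_add_one_le_of_block_le (hl0 : l 0 = 0) (hlm : l m = k)
    (hlmono : ∀ i < m, l i < l (i + 1)) {P : Fin k → MvPolynomial (Fin k) ℂ} {d : ℕ → ℕ}
    (hdeg : ∀ i, 1 ≤ i → i ≤ m → ∀ j : Fin k,
      l (i - 1) ≤ (j : ℕ) → (j : ℕ) < l i → (P j).totalDegree = d i)
    (hdmono : ∀ i, 1 ≤ i → i < m → d (i + 1) < d i) {r : ℕ} (hr : 1 ≤ r)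
    (hrm : r ≤ m) {j : Fin k} (hj : l r ≤ (j : ℕ)) : (P j).totalDegree + 1 ≤ d r := by
  have hlt : r < m := by
    refine lt_of_le_of_ne hrm ?_
    rintro rfl
    have := j.2
    omega
  have := totalDegree_le_of_block_le hl0 hlm hlmono hdeg hdmono (r := r + 1) (by omega) hlt
    (j := j) hj
  have := hdmono r hr hlt
  omega

end Blocks

section BlockNorm

variable {k : ℕ}

theorem blockNorm_le_norm (z : EuclideanSpace ℂ (Fin k)) (a b : ℕ) : blockNorm k z a b ≤ ‖z‖ := by
  rw [EuclideanSpace.norm_eq]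
  refine Real.sqrt_le_sqrt (Finset.sum_le_sum fun j _ => ?_)
  split_ifs
  · rfl
  · positivity

theorem norm_apply_le_blockNorm (z : EuclideanSpace ℂ (Fin k)) {a b : ℕ} {j : Fin k}
    (ha : a ≤ (j : ℕ)) (hb : (j : ℕ) < b) : ‖z j‖ ≤ blockNorm k z a b := by
  refine Real.le_sqrt_of_sq_le ?_
  have := Finset.single_le_sum
    (f := fun j : Fin k => if a ≤ (j : ℕ) ∧ (j : ℕ) < b then ‖z j‖ ^ 2 else 0)
    (fun j _ => by split_ifs <;> positivity) (Finset.mem_univ j)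
  simpa only [ha, hb, and_self, if_true] using this

theorem blockNorm_le_card_mul (z : EuclideanSpace ℂ (Fin k)) {a b : ℕ} {A : ℝ} (hA : 0 ≤ A)
    (h : ∀ j : Fin k, a ≤ (j : ℕ) → (j : ℕ) < b → ‖z j‖ ≤ A) : blockNorm k z a b ≤ k * A := by
  refine Real.sqrt_le_iff.2 ⟨by positivity, ?_⟩
  have hsum : (∑ j : Fin k, if a ≤ (j : ℕ) ∧ (j : ℕ) < b then ‖z j‖ ^ 2 else 0) ≤ k * A ^ 2 := by
    calc _ ≤ ∑ _j : Fin k, A ^ 2 := Finset.sum_le_sum fun j _ => by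
          split_ifs with hj
          · exact pow_le_pow_left₀ (norm_nonneg _) (h j hj.1 hj.2) 2
          · positivity
      _ = k * A ^ 2 := by simp
  have hk : (k : ℝ) ≤ (k : ℝ) ^ 2 := by exact_mod_cast Nat.le_self_pow two_ne_zero k
  rw [mul_pow]
  exact hsum.trans (by gcongr)

theorem blockNorm_zero_self (z : EuclideanSpace ℂ (Fin k)) : blockNorm k z 0 k = ‖z‖ := by
  rw [EuclideanSpace.norm_eq, blockNorm]
  simp

end BlockNorm

theorem isClosed_sigmaSet {k : ℕ} (P : Fin k → MvPolynomial (Fin k) ℂ) {l : ℕ → ℕ} {r : ℕ}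
    (hl : l (r - 1) ≤ l r) : IsClosed (sigmaSet k P l r) := by
  rw [sigmaSet_eq_zeros P hl]
  exact isClosed_sphere.inter (isClosed_eq (continuous_coneEqs k P _ _) continuous_const)

/-- The attracting sets are nonempty, because their cones are cut out by fewer than `k`
equations. -/
theorem sigmaSet_nonempty {k : ℕ} {P : Fin k → MvPolynomial (Fin k) ℂ} {l : ℕ → ℕ} {r : ℕ}
    (hl : l (r - 1) < l r) (hlk : l r ≤ k)
    (hdeg : ∀ j : Fin k, (j : ℕ) < l (r - 1) → 1 ≤ (P j).totalDegree) :
    (sigmaSet k P l r).Nonempty := by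
  classical
  set j₀ : Fin k := ⟨l (r - 1), hl.trans_le hlk⟩
  set Q : Fin k → MvPolynomial (Fin k) ℂ := fun j =>
    if (j : ℕ) < l (r - 1) then pPlus k P j else X j with hQ
  obtain ⟨w, hw0, hw⟩ := exists_ne_zero_common_zero ((Finset.univ.erase j₀).image Q)
    (by
      refine Finset.card_image_le.trans_lt ?_
      rw [Finset.card_erase_of_mem (Finset.mem_univ _), Finset.card_fin]
      have := j₀.pos
      omega)
    (fun p hp => by
      obtain ⟨j, -, rfl⟩ := Finset.mem_image.1 hp
      by_cases hj : (j : ℕ) < l (r - 1)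
      · simp only [hQ, if_pos hj]
        rw [eval_zero, constantCoeff_eq, pPlus, coeff_homogeneousComponent, if_neg]
        have := hdeg j hj
        rw [map_zero]
        omega
      · simp [hQ, hj])
  have hwQ : ∀ j, j ≠ j₀ → eval w (Q j) = 0 := fun j hj =>
    hw _ (Finset.mem_image_of_mem Q (Finset.mem_erase.2 ⟨hj, Finset.mem_univ j⟩))
  set z : EuclideanSpace ℂ (Fin k) := WithLp.toLp 2 w
  have hz0 : z ≠ 0 := fun h => hw0 (by simpa [z] using h)
  have hzw : (fun t => z t) = w := rfl
  refine ⟨‖z‖⁻¹ • z, mem_sphere_zero_iff_norm.1 (normalize_mem_sphere hz0), fun j hj => ?_,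
    fun j hj => ?_⟩
  · have h := hwQ j fun h => by simp [h, j₀] at hj
    simp only [hQ, if_pos hj] at h
    have hn := norm_eval_normalize (homogeneousComponent_isHomogeneous (P j).totalDegree (P j)) hz0
    rw [hzw, ← pPlus, h, norm_zero] at hn
    exact norm_eq_zero.1 ((mul_eq_zero.1 hn).resolve_right
      (pow_ne_zero _ (norm_ne_zero_iff.2 hz0)))
  · have h := hwQ j fun h => by
      simp only [h, j₀] at hj
      omega
    simp only [hQ, if_neg (not_lt.2 (hl.le.trans hj)), eval_X] at h
    simp [z, h]

/-- Points near infinity close to the linear subspace where the coordinates of index `≥ l r` vanish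
lie in one of the first `r` basins. -/
theorem exists_mem_basin_of_near {k m s : ℕ} (hk : 0 < k)
    {l : ℕ → ℕ} (hl0 : l 0 = 0) (hlm : l m = k) (hlmono : ∀ i < m, l i < l (i + 1))
    {P : Fin k → MvPolynomial (Fin k) ℂ} {d : ℕ → ℕ}
    (hdeg : ∀ i, 1 ≤ i → i ≤ m → ∀ j : Fin k,
      l (i - 1) ≤ (j : ℕ) → (j : ℕ) < l i → (P j).totalDegree = d i)
    (hdmono : ∀ i, 1 ≤ i → i < m → d (i + 1) < d i) (hdm : 1 ≤ d m)
    {f : EuclideanSpace ℂ (Fin k) → EuclideanSpace ℂ (Fin k)}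
    (hf : ∀ (z : EuclideanSpace ℂ (Fin k)) (j : Fin k), f z j = eval (fun t => z t) (P j))
    (hreg : ∀ r, 1 ≤ r → r ≤ s → ∀ z : Fin k → ℂ,
      (∀ j : Fin k, (j : ℕ) < l r → eval z (pPlus k P j) = 0) →
      (∀ j : Fin k, l r ≤ (j : ℕ) → z j = 0) → z = 0) (r : ℕ) (hrs : r ≤ s) (hrm : r < m) :
    ∃ R ε : ℝ, 0 < R ∧ 0 < ε ∧ ∀ z : EuclideanSpace ℂ (Fin k), R ≤ ‖z‖ →
      (∀ j : Fin k, l r ≤ (j : ℕ) → ‖z j‖ ≤ ε * ‖z‖) →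
      ∃ q, 1 ≤ q ∧ q ≤ r ∧ z ∈ basin k f P l q := by
  induction r with
  | zero =>
    have hkR : (0 : ℝ) < k := by exact_mod_cast hk
    refine ⟨1, 1 / (2 * k), one_pos, by positivity, fun z hz hnear => ?_⟩
    have h := blockNorm_le_card_mul z (a := 0) (b := k) (A := 1 / (2 * k) * ‖z‖) (by positivity)
      fun j _ _ => hnear j (by simp [hl0])
    rw [blockNorm_zero_self, ← mul_assoc, mul_one_div, div_mul_cancel_right₀ hkR.ne'] at h
    linarith
  | succ r ih =>
    obtain ⟨R', ε', -, hε', hbasin⟩ := ih (by omega) (by omega)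
    have hd1 : 1 ≤ d (r + 2) := hdm.trans (deg_le_of_le hdmono (by omega) (by omega) le_rfl)
    have hd2 : d (r + 2) < d (r + 1) := hdmono (r + 1) (by omega) hrm
    obtain ⟨R, ε, hR, hε, h⟩ := exists_mem_basin_or_near hf (l := l) (r := r + 1) (e := d (r + 1))
      (hlmono r (by omega)).le (by omega)
      (fun j hj => le_totalDegree_of_lt_block hl0 hlm hlmono hdeg hdmono (by omega) hj)
      (fun j hj => by
        rw [Nat.add_sub_cancel] at hj
        have hr : r ≠ 0 := fun h0 => by simp [h0, hl0] at hj
        exact (hdmono r (by omega) (by omega)).trans_le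
          (le_totalDegree_of_lt_block hl0 hlm hlmono hdeg hdmono (by omega) hj))
      (fun j hj => totalDegree_add_one_le_of_block_le hl0 hlm hlmono hdeg hdmono (by omega)
        (by omega) hj)
      (fun j hj => totalDegree_le_of_block_le hl0 hlm hlmono hdeg hdmono (by omega) (by omega) hj)
      (hreg (r + 1) (by omega) hrs) R' hε'
    refine ⟨R, ε, hR, hε, fun z hz hnear => ?_⟩
    rcases h z hz hnear with hz | ⟨n, hn, hn'⟩
    · exact ⟨r + 1, by omega, le_rfl, hz⟩
    · obtain ⟨q, hq1, hqr, hq⟩ := hbasin _ hn hn'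
      exact ⟨q, hq1, by omega, iterate_mem_basin hq⟩

/-- (Lemma 2.2, parts used for Theorem 2.1.) For a proper `s`-regular
map and `1 ≤ i ≤ s` (with `i < m` or `d_m ≥ 2`): near the attracting set `X_i` at
infinity and inside `K_{i−1}`, one has `|f_{(i)}(z)| ∼ |z|^{d_i}`, `|f(z)| ∼ |z|^{d_i}`
and `|f_{(>i)}(z)| = o(|z|^{d_i})`. -/
theorem stmt5 (k m s : ℕ) (hk : 0 < k)
    (l : ℕ → ℕ) (hl0 : l 0 = 0) (hlm : l m = k)
    (hlmono : ∀ i < m, l i < l (i + 1))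
    (P : Fin k → MvPolynomial (Fin k) ℂ)
    (d : ℕ → ℕ)
    (hdeg : ∀ i, 1 ≤ i → i ≤ m → ∀ j : Fin k,
      l (i - 1) ≤ (j : ℕ) → (j : ℕ) < l i → (P j).totalDegree = d i)
    (hdmono : ∀ i, 1 ≤ i → i < m → d (i + 1) < d i)
    (hdm : 1 ≤ d m)
    (f : EuclideanSpace ℂ (Fin k) → EuclideanSpace ℂ (Fin k))
    (hf : ∀ (z : EuclideanSpace ℂ (Fin k)) (j : Fin k),
      f z j = eval (fun t => z t) (P j))
    (hproper : IsProperMap f)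
    (hs1 : 1 ≤ s) (hsm : s ≤ m)
    (hreg : ∀ r, 1 ≤ r → r ≤ s → ∀ z : Fin k → ℂ,
      (∀ j : Fin k, (j : ℕ) < l r → eval z (pPlus k P j) = 0) →
      (∀ j : Fin k, l r ≤ (j : ℕ) → z j = 0) → z = 0)
    (i : ℕ) (hi1 : 1 ≤ i) (his : i ≤ s)
    (hcase : i < m ∨ 2 ≤ d m) :
    (∃ c c' R₀ ε₀ : ℝ, 0 < c ∧ c ≤ c' ∧ 0 < R₀ ∧ 0 < ε₀ ∧
      ∀ z ∈ kSet k f P l (i - 1), R₀ ≤ ‖z‖ →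
        infDist (‖z‖⁻¹ • z) (sigmaSet k P l i) ≤ ε₀ →
          (c * ‖z‖ ^ (d i : ℝ) ≤ blockNorm k (f z) (l (i - 1)) (l i) ∧
           blockNorm k (f z) (l (i - 1)) (l i) ≤ c' * ‖z‖ ^ (d i : ℝ) ∧
           c * ‖z‖ ^ (d i : ℝ) ≤ ‖f z‖ ∧ ‖f z‖ ≤ c' * ‖z‖ ^ (d i : ℝ))) ∧
    (∀ δ : ℝ, 0 < δ → ∃ R ε : ℝ, 0 < R ∧ 0 < ε ∧
      ∀ z ∈ kSet k f P l (i - 1), R ≤ ‖z‖ →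
        infDist (‖z‖⁻¹ • z) (sigmaSet k P l i) ≤ ε →
          blockNorm k (f z) (l i) k ≤ δ * ‖z‖ ^ (d i : ℝ)) := by
  have him : i ≤ m := his.trans hsm
  have hli : l (i - 1) < l i := by
    have := hlmono (i - 1) (by omega)
    rwa [Nat.sub_add_cancel hi1] at this
  have hlik : l i ≤ k := hlm ▸ block_le_of_le hlmono him le_rfl
  have hdi : 1 ≤ d i := hdm.trans (deg_le_of_le hdmono hi1 him le_rfl)
  obtain ⟨C, hC0, hC⟩ := exists_norm_apply_le hf
  simp only [Real.rpow_natCast]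
  constructor
  · have hne : (sigmaSet k P l i).Nonempty := sigmaSet_nonempty hli hlik fun j hj =>
      hdi.trans (le_totalDegree_of_lt_block hl0 hlm hlmono hdeg hdmono him (hj.trans hli))
    obtain ⟨c, hc, hle⟩ := (isCompact_sphere (0 : EuclideanSpace ℂ (Fin k))
      1).exists_le_norm_of_infDist_le (isClosed_sigmaSet P hli.le) hne
      (F := fun w (j : Fin k) => if l (i - 1) ≤ (j : ℕ) ∧ (j : ℕ) < l i then
        eval (fun t => w t) (pPlus k P j) else 0)
      (continuous_pi fun j => by
        split_ifs
        · exact continuous_eval_coords _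
        · exact continuous_const)
      (fun w hw h0 => by
        have hw0 : (fun t => w t) = 0 := hreg i hi1 his _ (fun j hj => by
          by_cases hj' : (j : ℕ) < l (i - 1)
          · exact hw.2.1 j hj'
          · simpa [not_lt.1 hj', hj] using congrFun h0 j) hw.2.2
        have : w = 0 := by
          ext j
          exact congrFun hw0 j
        simpa [this] using hw.1)
    obtain ⟨R₁, hR₁, hlow⟩ := exists_le_norm_apply hf hc
    obtain ⟨R₂, ε₂, hR₂, hε₂, hbasin⟩ := exists_mem_basin_of_near hk hl0 hlm hlmono hdeg hdmono hdm
      hf hreg (i - 1) (by omega) (by omega)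
    have hupper : ∀ z ∈ kSet k f P l (i - 1), max R₁ R₂ ≤ ‖z‖ →
        ‖f z‖ ≤ max 1 (C / ε₂) * ‖z‖ ^ d i := by
      intro z hzK hz
      by_contra! hlt
      have hz1 : 1 ≤ ‖z‖ := hR₁.trans ((le_max_left _ _).trans hz)
      have hfz : ‖z‖ ^ d i ≤ ‖f z‖ :=
        (le_mul_of_one_le_left (by positivity) (le_max_left _ _)).trans hlt.le
      obtain ⟨q, hq1, hqi, hq⟩ := hbasin (f z)
        (((le_max_right _ _).trans hz).trans ((le_self_pow₀ hz1 (by omega)).trans hfz))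
        fun j hj => (hC z hz1 j (d i) (totalDegree_le_of_block_le hl0 hlm hlmono hdeg hdmono hi1
          him hj)).trans (by
            have h1 : C / ε₂ * ‖z‖ ^ d i ≤ ‖f z‖ :=
              (mul_le_mul_of_nonneg_right (le_max_right _ _) (by positivity)).trans hlt.le
            rwa [div_mul_eq_mul_div, div_le_iff₀' hε₂] at h1)
      exact hzK q hq1 hqi (iterate_mem_basin (n := 1) hq)
    refine ⟨c / 2, max (c / 2) (max 1 (C / ε₂)), max R₁ R₂, c, half_pos hc, le_max_left _ _,
      lt_max_of_lt_right hR₂, hc, fun z hzK hz hd => ?_⟩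
    have hz1 : R₁ ≤ ‖z‖ := (le_max_left _ _).trans hz
    have hz0 : z ≠ 0 := norm_pos_iff.1 (by linarith)
    have hup : ‖f z‖ ≤ max (c / 2) (max 1 (C / ε₂)) * ‖z‖ ^ d i :=
      (hupper z hzK hz).trans
        (mul_le_mul_of_nonneg_right (le_max_right _ _) (by positivity))
    have hlo : c / 2 * ‖z‖ ^ d i ≤ blockNorm k (f z) (l (i - 1)) (l i) := by
      obtain ⟨j, hj⟩ : ∃ j : Fin k, c ≤ ‖if l (i - 1) ≤ (j : ℕ) ∧ (j : ℕ) < l i then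
          eval (fun t => (‖z‖⁻¹ • z) t) (pPlus k P j) else 0‖ := by
        by_contra! hlt
        exact absurd ((pi_norm_lt_iff hc).2 hlt)
          (not_lt.2 (hle _ (normalize_mem_sphere hz0) hd))
      split_ifs at hj with hij
      · exact (hlow z hz1 j (d i) hdi (le_totalDegree_of_lt_block hl0 hlm hlmono hdeg hdmono him
          hij.2) hj).trans (norm_apply_le_blockNorm _ hij.1 hij.2)
      · rw [norm_zero] at hj
        linarith
    have hbn := blockNorm_le_norm (f z) (l (i - 1)) (l i)
    exact ⟨hlo, hbn.trans hup, hlo.trans hbn, hup⟩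
  · intro δ hδ
    refine ⟨max 1 (k * C / δ), 1, lt_max_of_lt_left one_pos, one_pos, fun z _ hz _ => ?_⟩
    have hz1 : 1 ≤ ‖z‖ := (le_max_left _ _).trans hz
    have hz2 : k * C ≤ δ * ‖z‖ := (div_le_iff₀' hδ).1 ((le_max_right _ _).trans hz)
    have hdi' : ‖z‖ ^ d i = ‖z‖ * ‖z‖ ^ (d i - 1) := by
      rw [← pow_succ', Nat.sub_add_cancel hdi]
    refine (blockNorm_le_card_mul (f z) (A := C * ‖z‖ ^ (d i - 1)) (by positivity)
      fun j hj _ => hC z hz1 j _ ?_).trans ?_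
    · have := totalDegree_add_one_le_of_block_le hl0 hlm hlmono hdeg hdmono hi1 him hj
      omega
    · rw [hdi', ← mul_assoc, ← mul_assoc]
      gcongr
end
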